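/- For all a1, a2, a3, a4, a5, a6 in F, one has [[a1,a2] a3 [a4,a5], a6] = 0, and consequently [a1,a2] a3 [a4,a5,a6] + [a1,a2,a6] a3 [a4,a5] = 0; that is, the polynomial [[t1,t2] t3 [t4,t5], t6] is a polynomial identity of F. -/

import Mathlib

open scoped TensorProduct

noncomputable section

/-- The free supercommutative algebra on four even variables `x1, x2, x1', x2'` and four odd
variables `y1, y2, y1', y2'`: the tensor product of a polynomial ring in four variables with
the exterior algebra on a four-dimensional space. -/
abbrev FreeSuperComm (K : Type*) [Field K] :=
  (MvPolynomial (Fin 4) K) ⊗[K] (ExteriorAlgebra K (Fin 4 → K))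

/-- The even generators: `xg K 0 = x1`, `xg K 1 = x1'`, `xg K 2 = x2`, `xg K 3 = x2'`. -/
def xg (K : Type*) [Field K] (i : Fin 4) : FreeSuperComm K :=
  (MvPolynomial.X i) ⊗ₜ[K] 1

/-- The odd generators: `yg K 0 = y1`, `yg K 1 = y1'`, `yg K 2 = y2`, `yg K 3 = y2'`. -/
def yg (K : Type*) [Field K] (i : Fin 4) : FreeSuperComm K :=
  1 ⊗ₜ[K] (ExteriorAlgebra.ι K (Pi.single i 1))

/-- The generic matrix `C1 = (x1, y1; y1', x1')`. -/
def genC₁ (K : Type*) [Field K] : Matrix (Fin 2) (Fin 2) (FreeSuperComm K) :=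
  !![xg K 0, yg K 0; yg K 1, xg K 1]

/-- The generic matrix `C2 = (x2, y2; y2', x2')`. -/
def genC₂ (K : Type*) [Field K] : Matrix (Fin 2) (Fin 2) (FreeSuperComm K) :=
  !![xg K 2, yg K 2; yg K 3, xg K 3]

/-- `F = K[C1, C2]`, the unital subalgebra generated by the two generic matrices. -/
def Falg (K : Type*) [Field K] : Subalgebra K (Matrix (Fin 2) (Fin 2) (FreeSuperComm K)) :=
  Algebra.adjoin K {genC₁ K, genC₂ K}

set_option linter.unusedSimpArgs false
set_option linter.unusedVariables false

section Abs
variable {Z R : Type*} [CommRing Z] [Ring R] [Algebra Z R]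

theorem anti_assoc {x y : R} (h : y * x = -(x * y)) (m : R) : y * (x * m) = -(x * (y * m)) := by
  rw [← mul_assoc, h, neg_mul, mul_assoc]

theorem zero_assoc {x y : R} (h : y * x = 0) (m : R) : y * (x * m) = 0 := by
  rw [← mul_assoc, h, zero_mul]

theorem final_lemma (a d p s e f t : Z) (b q u w c r v z : R) (ht : t = a - d)
    (hcan : ∀ x : R, t • x = 0 → x = 0)
    (ub : u * b = -(b * u)) (wb : w * b = -(b * w))
    (cb : c * b = -(b * c)) (rb : r * b = -(b * r)) (vb : v * b = -(b * v)) (zb : z * b = -(b * z))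
    (cu : c * u = -(u * c)) (ru : r * u = -(u * r)) (vu : v * u = -(u * v)) (zu : z * u = -(u * z))
    (cw : c * w = -(w * c)) (rw' : r * w = -(w * r)) (vw : v * w = -(w * v))
    (zw : z * w = -(w * z))
    (vq : v * q = -(q * v)) (zq : z * q = -(q * z)) (cq : c * q = -(q * c))
    (rc : r * c = -(c * r)) (qb : q * b = -(b * q)) (vc : v * c = -(c * v)) (zc : z * c = -(c * z)) 
    (uw : u * w = 0) (vz : v * z = 0)
    (efb : (e * f) • b = 0) (efc : (e * f) • c = 0) (efq : (e * f) • q = 0) (efr : (e * f) • r = 0)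
    (fub : f • (b * u) = 0) (ewb : e • (b * w) = 0) (eqb : e • (b * q) = 0) (fqb : f • (b * q) = 0)
    (frc : f • (c * r) = 0) (erc : e • (c * r) = 0) (ezc : e • (c * z) = 0) (fvc : f • (c * v) = 0)
    (H1 : (t * e) • w = -(b * (v * w))) (H2 : (t * f) • u = -(b * (z * u)))
    (H3 : (t * e) • z = -(u * (c * z))) (H4 : (t * f) • v = -(w * (c * v))) :
    !![e • (1 : R), u; v, e • (1 : R)] * !![p • (1 : R), q; r, s • (1 : R)]
      * !![f • (1 : R), w; z, f • (1 : R)] * !![a • (1 : R), b; c, d • (1 : R)]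
    = !![a • (1 : R), b; c, d • (1 : R)] *
     (!![e • (1 : R), u; v, e • (1 : R)] * !![p • (1 : R), q; r, s • (1 : R)]
      * !![f • (1 : R), w; z, f • (1 : R)]) := by
  have key : !![e • (1 : R), u; v, e • (1 : R)] * !![p • (1 : R), q; r, s • (1 : R)]
      * !![f • (1 : R), w; z, f • (1 : R)] =
      !![(e * p * f) • (1 : R) + f • (u * r) + e • (q * z) + s • (u * z), (e * p) • w + (s * f) • u;
        (p * f) • v + (e * s) • z, p • (v * w) + e • (r * w) + f • (v * q) + (e * s * f) • 1] := by
    have h1 : (e * f) • q = 0 := efq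
    have h2 : (e * f) • r = 0 := efr
    have h3 : u * (r * w) = 0 := by rw [rw', mul_neg, ← mul_assoc, uw]; simp
    have h4 : v * (q * z) = 0 := by
      rw [← mul_assoc, vq, neg_mul, mul_assoc, vz]; simp
    ext i j
    fin_cases i <;> fin_cases j <;>
      simp [Matrix.mul_apply, Fin.sum_univ_two, add_mul, mul_add, smul_smul, mul_assoc, h3, h4]
    · module
    · linear_combination (norm := module) (1 : Z) • h1
    · linear_combination (norm := module) (1 : Z) • h2
    · module
  rw [key]
  subst ht
  have c1 := anti_assoc cb
  have c2 := anti_assoc rb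
  have c3 := anti_assoc vb
  have c4 := anti_assoc zb
  have c5 := anti_assoc ub
  have c6 := anti_assoc wb
  have c7 := anti_assoc cu
  have c8 := anti_assoc cw
  have c9 := anti_assoc vu
  have c10 := anti_assoc vw
  have c11 := anti_assoc zu
  have c12 := anti_assoc zw
  have c13 := anti_assoc cq
  have c14 := anti_assoc vc
  have c16 := anti_assoc rc
  have c17 := anti_assoc qb
  have c15 := anti_assoc zc
  have R1 := congrArg (· * c) H1
  have R2 := congrArg (· * c) H2
  have L3 := congrArg (b * ·) H3
  have L4 := congrArg (b * ·) H4
  have f1 := congrArg (· * r) fub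
  have f2 := congrArg (· * r) ewb
  have f3 := congrArg (· * z) eqb
  have f4 := congrArg (· * v) fqb
  have f5 := congrArg (u * ·) frc
  have f6 := congrArg (w * ·) erc
  have f7 := congrArg (q * ·) ezc
  have f8 := congrArg (q * ·) fvc
  simp only [smul_mul_assoc, mul_smul_comm, mul_assoc, neg_mul, mul_neg, zero_mul, mul_zero,
    cb, rb, vb, zb, ub, wb, cu, ru, vu, zu, cw, rw', vw, zw, vq, zq, cq, vc, zc, rc, qb, c16, c17,
    c1, c2, c3, c4, c5, c6, c7, c8, c9, c10, c11, c12, c13, c14, c15, neg_neg, smul_neg] at R1 R2 L3 L4 f1 f2 f3 f4 f5 f6 f7 f8 H1 H2 H3 H4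
  ext i j
  fin_cases i <;> fin_cases j <;>
    simp only [Matrix.mul_apply, Fin.sum_univ_two, add_mul, mul_add, smul_smul, mul_assoc, Matrix.of_apply, Matrix.cons_val_zero, Matrix.cons_val_one, Matrix.cons_val', Matrix.cons_val_fin_one, Fin.zero_eta, Fin.mk_one, Fin.isValue, smul_mul_assoc, mul_smul_comm, neg_mul, mul_neg, one_mul, mul_one,
    cb, rb, vb, zb, ub, wb, cu, ru, vu, zu, cw, rw', vw, zw, vq, zq, cq, vc, zc, rc, qb, c16, c17,
    c1, c2, c3, c4, c5, c6, c7, c8, c9, c10, c11, c12, c13, c14, c15, neg_neg, smul_neg]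
  · apply sub_eq_zero.1
    apply hcan
    linear_combination (norm := module) p • R1 + s • R2 - s • L3 - p • L4
  · linear_combination (norm := module) p • efb - s • efb + (1 : Z) • (f1 + f2 + f3 + f4) - p • H1 - s • H2
  · linear_combination (norm := module) s • efc - p • efc + (1 : Z) • (f5 + f6 + f7 + f8) + p • H4 + s • H3
  · apply sub_eq_zero.1
    apply hcan
    linear_combination (norm := module) p • R1 + s • R2 - s • L3 - p • L4
end Abs

section Abs2
variable {Z R : Type*} [CommRing Z] [Ring R] [Algebra Z R]

structure SCS (y1 y2 z1 z2 : R) (q11 q12 q21 q22 : Z) : Prop where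
  y11 : y1 * y1 = 0
  y22 : y2 * y2 = 0
  z11 : z1 * z1 = 0
  z22 : z2 * z2 = 0
  y21 : y2 * y1 = -(y1 * y2)
  z21 : z2 * z1 = -(z1 * z2)
  z1y1 : z1 * y1 = -(y1 * z1)
  z1y2 : z1 * y2 = -(y2 * z1)
  z2y1 : z2 * y1 = -(y1 * z2)
  z2y2 : z2 * y2 = -(y2 * z2)
  h11 : y1 * z1 = q11 • (1 : R)
  h12 : y1 * z2 = q12 • (1 : R)
  h21 : y2 * z1 = q21 • (1 : R)
  h22 : y2 * z2 = q22 • (1 : R)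

def Lin (Z : Type*) {R : Type*} [CommRing Z] [Ring R] [Algebra Z R] (y1 y2 x : R) : Prop :=
  ∃ α β : Z, x = α • y1 + β • y2

def Good (Z : Type*) {R : Type*} [CommRing Z] [Ring R] [Algebra Z R] (y1 y2 z1 z2 : R) (t1 t2 : Z)
    (M : Matrix (Fin 2) (Fin 2) R) : Prop :=
  ∃ a d α β γ δ : Z, M = !![a • (1 : R), α • y1 + β • y2; γ • z1 + δ • z2, d • (1 : R)] ∧
    (a - d) • (y1 * y2) = (α * t1 + β * t2) • (y1 * y2) ∧
    (a - d) • (z1 * z2) = (γ * t1 + δ * t2) • (z1 * z2)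

theorem Lin.comb {y1 y2 x y : R} (hx : Lin Z y1 y2 x) (hy : Lin Z y1 y2 y) (k l : Z) :
    Lin Z y1 y2 (k • x - l • y) := by
  obtain ⟨a, b, rfl⟩ := hx
  obtain ⟨a', b', rfl⟩ := hy
  exact ⟨k * a - l * a', k * b - l * b', by module⟩

theorem lin_mul {y1 y2 x y : R} (y11 : y1 * y1 = 0) (y22 : y2 * y2 = 0)
    (y21 : y2 * y1 = -(y1 * y2)) (hx : Lin Z y1 y2 x) (hy : Lin Z y1 y2 y) :
    ∃ k : Z, x * y = k • (y1 * y2) := by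
  obtain ⟨a, b, rfl⟩ := hx
  obtain ⟨a', b', rfl⟩ := hy
  refine ⟨a * b' - b * a', ?_⟩
  simp only [add_mul, mul_add, smul_mul_assoc, mul_smul_comm, y11, y22, y21]
  module

theorem lin_anti {y1 y2 x y : R} (y11 : y1 * y1 = 0) (y22 : y2 * y2 = 0)
    (y21 : y2 * y1 = -(y1 * y2)) (hx : Lin Z y1 y2 x) (hy : Lin Z y1 y2 y) :
    y * x = -(x * y) := by
  obtain ⟨a, b, rfl⟩ := hx
  obtain ⟨a', b', rfl⟩ := hy
  simp only [add_mul, mul_add, smul_mul_assoc, mul_smul_comm, y11, y22, y21]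
  module

/-- the key vanishing `u * w = 0` -/
theorem uw_zero {y1 y2 : R} (y11 : y1 * y1 = 0) (y22 : y2 * y2 = 0)
    (y21 : y2 * y1 = -(y1 * y2)) (t1 t2 tA α1 α2 tB β1 β2 tD δ1 δ2 tE ε1 ε2 : Z)
    (hA : tA • (y1 * y2) = (α1 * t1 + α2 * t2) • (y1 * y2))
    (hB : tB • (y1 * y2) = (β1 * t1 + β2 * t2) • (y1 * y2))
    (hD : tD • (y1 * y2) = (δ1 * t1 + δ2 * t2) • (y1 * y2))
    (hE : tE • (y1 * y2) = (ε1 * t1 + ε2 * t2) • (y1 * y2)) :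
    (tA • (β1 • y1 + β2 • y2) - tB • (α1 • y1 + α2 • y2)) *
      (tD • (ε1 • y1 + ε2 • y2) - tE • (δ1 • y1 + δ2 • y2)) = 0 := by
  simp only [sub_mul, mul_sub, smul_add, add_mul, mul_add, smul_mul_assoc, mul_smul_comm,
    y11, y22, y21]
  linear_combination (norm := module)
    (β1 * (tD * ε2 - tE * δ2) - β2 * (tD * ε1 - tE * δ1)) • hA
    - (α1 * (tD * ε2 - tE * δ2) - α2 * (tD * ε1 - tE * δ1)) • hB
    - ((α1 * β2 - α2 * β1) * (t1 * ε1 + t2 * ε2)) • hD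
    + ((α1 * β2 - α2 * β1) * (t1 * δ1 + t2 * δ2)) • hE

variable {y1 y2 z1 z2 : R} {q11 q12 q21 q22 : Z}

theorem SCS.cb (S : SCS y1 y2 z1 z2 q11 q12 q21 q22) {b c : R} (hb : Lin Z y1 y2 b)
    (hc : Lin Z z1 z2 c) : c * b = -(b * c) := by
  obtain ⟨a, b, rfl⟩ := hb
  obtain ⟨a', b', rfl⟩ := hc
  simp only [add_mul, mul_add, smul_mul_assoc, mul_smul_comm, S.z1y1, S.z1y2, S.z2y1, S.z2y2]
  module

theorem SCS.bc (S : SCS y1 y2 z1 z2 q11 q12 q21 q22) {b c : R} (hb : Lin Z y1 y2 b)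
    (hc : Lin Z z1 z2 c) : ∃ n : Z, b * c = n • (1 : R) ∧ n • (y1 * y2) = 0 ∧ n • (z1 * z2) = 0 := by
  have hb' := hb
  have hc' := hc
  obtain ⟨k, l, hb0⟩ := hb
  obtain ⟨m, n, hc0⟩ := hc
  have h : b * c = (k * m * q11 + k * n * q12 + l * m * q21 + l * n * q22) • (1 : R) := by
    rw [hb0, hc0]
    simp only [add_mul, mul_add, smul_mul_assoc, mul_smul_comm, S.h11, S.h12, S.h21, S.h22]
    module
  refine ⟨_, h, ?_, ?_⟩
  · have : (b * c) * (y1 * y2) = 0 := by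
      have h1 := S.cb (b := y1) ⟨1, 0, by simp⟩ hc'
      have h2 := S.cb (b := y2) ⟨0, 1, by simp⟩ hc'
      rw [mul_assoc, ← mul_assoc c, h1, neg_mul, mul_assoc, h2, hb0]
      simp only [add_mul, mul_add, smul_mul_assoc, mul_neg, ← mul_assoc, S.y11, S.y22, S.y21, neg_mul]
      simp [mul_assoc, S.y22, zero_assoc S.y22]
    rw [h] at this
    simpa using this
  · have : (b * c) * (z1 * z2) = 0 := by
      rw [mul_assoc, ← mul_assoc c, hc0]
      simp only [add_mul, mul_add, smul_mul_assoc, mul_neg, S.z11, S.z22, S.z21, neg_mul]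
      simp [mul_assoc, S.z22]
    rw [h] at this
    simpa using this

theorem Good.add {t1 t2 : Z} {M N : Matrix (Fin 2) (Fin 2) R}
    (hM : Good Z y1 y2 z1 z2 t1 t2 M) (hN : Good Z y1 y2 z1 z2 t1 t2 N) :
    Good Z y1 y2 z1 z2 t1 t2 (M + N) := by
  obtain ⟨a, d, α, β, γ, δ, rfl, h1, h2⟩ := hM
  obtain ⟨a', d', α', β', γ', δ', rfl, h1', h2'⟩ := hN
  refine ⟨a + a', d + d', α + α', β + β', γ + γ', δ + δ', ?_, ?_, ?_⟩
  · ext i j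
    fin_cases i <;> fin_cases j <;> simp <;> module
  · linear_combination (norm := module) (1 : Z) • (h1 + h1')
  · linear_combination (norm := module) (1 : Z) • (h2 + h2')

theorem Good.scal {t1 t2 : Z} (k : Z) :
    Good Z y1 y2 z1 z2 t1 t2 !![k • (1 : R), 0; 0, k • (1 : R)] :=
  ⟨k, k, 0, 0, 0, 0, by simp, by simp, by simp⟩

theorem Good.mul (S : SCS y1 y2 z1 z2 q11 q12 q21 q22) {t1 t2 : Z} {M N : Matrix (Fin 2) (Fin 2) R}
    (hM : Good Z y1 y2 z1 z2 t1 t2 M) (hN : Good Z y1 y2 z1 z2 t1 t2 N) :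
    Good Z y1 y2 z1 z2 t1 t2 (M * N) := by
  obtain ⟨a, d, α, β, γ, δ, rfl, h1, h2⟩ := hM
  obtain ⟨a', d', α', β', γ', δ', rfl, h1', h2'⟩ := hN
  obtain ⟨n, e1, e2, e3⟩ := S.bc (b := α • y1 + β • y2) (c := γ' • z1 + δ' • z2)
    ⟨_, _, rfl⟩ ⟨_, _, rfl⟩
  obtain ⟨m, f1, f2, f3⟩ := S.bc (b := α' • y1 + β' • y2) (c := γ • z1 + δ • z2)
    ⟨_, _, rfl⟩ ⟨_, _, rfl⟩
  have f4 := S.cb (b := α' • y1 + β' • y2) (c := γ • z1 + δ • z2)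
    ⟨_, _, rfl⟩ ⟨_, _, rfl⟩
  rw [f1] at f4
  refine ⟨a * a' + n, d * d' - m, a * α' + d' * α, a * β' + d' * β,
    a' * γ + d * γ', a' * δ + d * δ', ?_, ?_, ?_⟩
  · ext i j
    fin_cases i <;> fin_cases j <;>
      simp only [Matrix.mul_apply, Fin.sum_univ_two, Matrix.of_apply, Matrix.cons_val_zero,
        Matrix.cons_val_one, Matrix.cons_val', Matrix.cons_val_fin_one, Fin.zero_eta, Fin.mk_one,
        Fin.isValue, e1, f4, smul_mul_assoc, mul_smul_comm, one_mul, mul_one] <;> module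
  · linear_combination (norm := module) a • h1' + d' • h1 + (1 : Z) • (e2 + f2)
  · linear_combination (norm := module) d • h2' + a' • h2 + (1 : Z) • (e3 + f3)

theorem te_w (tA tB t e : Z) (bA bB cA cB b u v w : R)
    (he : e • (1 : R) = bA * cB - bB * cA)
    (hv : v = tB • cA - tA • cB)
    (hA : t • (bA * w) = tA • (b * w)) (hB : t • (bB * w) = tB • (b * w))
    (h1 : cA * w = -(w * cA)) (h2 : cB * w = -(w * cB)) :
    (t * e) • w = -(b * (v * w)) := by
  have h3 : (t * e) • w = t • ((e • (1 : R)) * w) := by simp [smul_smul]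
  have h4 := congrArg (· * cB) hA
  have h5 := congrArg (· * cA) hB
  rw [h3, he, hv]
  simp only [sub_mul, mul_sub, smul_mul_assoc, mul_smul_comm, mul_assoc, h1, h2, mul_neg] at h4 h5 ⊢
  linear_combination (norm := module) (1 : Z) • (h5 - h4)

theorem te_z (tA tB t e : Z) (bA bB cA cB c u z : R)
    (he : e • (1 : R) = bA * cB - bB * cA)
    (hu : u = tA • bB - tB • bA)
    (hA : t • (cA * z) = tA • (c * z)) (hB : t • (cB * z) = tB • (c * z)) :
    (t * e) • z = -(u * (c * z)) := by
  have h3 : (t * e) • z = t • ((e • (1 : R)) * z) := by simp [smul_smul]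
  have h4 := congrArg (bB * ·) hA
  have h5 := congrArg (bA * ·) hB
  rw [h3, he, hu]
  simp only [sub_mul, mul_sub, smul_mul_assoc, mul_smul_comm, mul_assoc, mul_neg] at h4 h5 ⊢
  linear_combination (norm := module) (1 : Z) • (h5 - h4)

/-- shape of the commutator -/
theorem comm_shape (S : SCS y1 y2 z1 z2 q11 q12 q21 q22) (a d a' d' : Z) (b c b' c' : R)
    (hb : Lin Z y1 y2 b) (hb' : Lin Z y1 y2 b') (hc : Lin Z z1 z2 c) (hc' : Lin Z z1 z2 c') :
    ∃ e : Z, e • (1 : R) = b * c' - b' * c ∧ e • (y1 * y2) = 0 ∧ e • (z1 * z2) = 0 ∧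
      !![a • (1 : R), b; c, d • (1 : R)] * !![a' • (1 : R), b'; c', d' • (1 : R)]
      - !![a' • (1 : R), b'; c', d' • (1 : R)] * !![a • (1 : R), b; c, d • (1 : R)]
      = !![e • (1 : R), (a - d) • b' - (a' - d') • b; (a' - d') • c - (a - d) • c', e • (1 : R)] := by
  obtain ⟨n, e1, e2, e3⟩ := S.bc hb hc'
  obtain ⟨m, f1, f2, f3⟩ := S.bc hb' hc
  have g1 := S.cb hb hc'
  have g2 := S.cb hb' hc
  rw [e1] at g1
  rw [f1] at g2
  refine ⟨n - m, by rw [e1, f1]; module, by rw [sub_smul, e2, f2, sub_zero],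
    by rw [sub_smul, e3, f3, sub_zero], ?_⟩
  ext i j
  fin_cases i <;> fin_cases j <;>
      simp only [Matrix.sub_apply, Matrix.mul_apply, Fin.sum_univ_two, Matrix.of_apply,
        Matrix.cons_val_zero,
        Matrix.cons_val_one, Matrix.cons_val', Matrix.cons_val_fin_one, Fin.zero_eta, Fin.mk_one,
        Fin.isValue, e1, f1, g1, g2, smul_mul_assoc, mul_smul_comm, one_mul, mul_one] <;> module

theorem main_abs (S : SCS y1 y2 z1 z2 q11 q12 q21 q22) {t1 t2 : Z}
    {A B M D E : Matrix (Fin 2) (Fin 2) R}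
    (hA : Good Z y1 y2 z1 z2 t1 t2 A) (hB : Good Z y1 y2 z1 z2 t1 t2 B)
    (hM : Good Z y1 y2 z1 z2 t1 t2 M) (hD : Good Z y1 y2 z1 z2 t1 t2 D)
    (hE : Good Z y1 y2 z1 z2 t1 t2 E) (a d α β γ δ : Z)
    (hC1 : (a - d) • (y1 * y2) = (α * t1 + β * t2) • (y1 * y2))
    (hC2 : (a - d) • (z1 * z2) = (γ * t1 + δ * t2) • (z1 * z2))
    (hcan : ∀ x : R, (a - d) • x = 0 → x = 0) :
    ((A * B - B * A) * M * (D * E - E * D)) *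
        !![a • (1 : R), α • y1 + β • y2; γ • z1 + δ • z2, d • (1 : R)]
      = !![a • (1 : R), α • y1 + β • y2; γ • z1 + δ • z2, d • (1 : R)] *
        ((A * B - B * A) * M * (D * E - E * D)) := by
  obtain ⟨aA, dA, A1, A2, A3, A4, rfl, hA1, hA2⟩ := hA
  obtain ⟨aB, dB, B1, B2, B3, B4, rfl, hB1, hB2⟩ := hB
  obtain ⟨p, s, M1, M2, M3, M4, rfl, hM1, hM2⟩ := hM
  obtain ⟨aD, dD, D1, D2, D3, D4, rfl, hD1, hD2⟩ := hD
  obtain ⟨aE, dE, E1, E2, E3, E4, rfl, hE1, hE2⟩ := hE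
  -- vanishing facts
  have U := fun tA α1 α2 tB β1 β2 tD δ1 δ2 tE ε1 ε2 hA hB hD hE =>
    uw_zero (Z := Z) S.y11 S.y22 S.y21 t1 t2 tA α1 α2 tB β1 β2 tD δ1 δ2 tE ε1 ε2 hA hB hD hE
  have V := fun tA α1 α2 tB β1 β2 tD δ1 δ2 tE ε1 ε2 hA hB hD hE =>
    uw_zero (Z := Z) S.z11 S.z22 S.z21 t1 t2 tA α1 α2 tB β1 β2 tD δ1 δ2 tE ε1 ε2 hA hB hD hE
  have uw := U _ _ _ _ _ _ _ _ _ _ _ _ hA1 hB1 hD1 hE1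
  have vz := V _ _ _ _ _ _ _ _ _ _ _ _ hB2 hA2 hE2 hD2
  have uAw := U _ _ _ _ _ _ _ _ _ _ _ _ hC1 hA1 hD1 hE1
  have uBw := U _ _ _ _ _ _ _ _ _ _ _ _ hC1 hB1 hD1 hE1
  have uDu := U _ _ _ _ _ _ _ _ _ _ _ _ hC1 hD1 hA1 hB1
  have uEu := U _ _ _ _ _ _ _ _ _ _ _ _ hC1 hE1 hA1 hB1
  have vAz := V _ _ _ _ _ _ _ _ _ _ _ _ hC2 hA2 hE2 hD2
  have vBz := V _ _ _ _ _ _ _ _ _ _ _ _ hC2 hB2 hE2 hD2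
  have vDv := V _ _ _ _ _ _ _ _ _ _ _ _ hC2 hD2 hB2 hA2
  have vEv := V _ _ _ _ _ _ _ _ _ _ _ _ hC2 hE2 hB2 hA2
  clear U V
  have lA : Lin Z y1 y2 (A1 • y1 + A2 • y2) := ⟨_, _, rfl⟩
  have lB : Lin Z y1 y2 (B1 • y1 + B2 • y2) := ⟨_, _, rfl⟩
  have lM : Lin Z y1 y2 (M1 • y1 + M2 • y2) := ⟨_, _, rfl⟩
  have lD : Lin Z y1 y2 (D1 • y1 + D2 • y2) := ⟨_, _, rfl⟩
  have lE : Lin Z y1 y2 (E1 • y1 + E2 • y2) := ⟨_, _, rfl⟩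
  have lC : Lin Z y1 y2 (α • y1 + β • y2) := ⟨_, _, rfl⟩
  have mA : Lin Z z1 z2 (A3 • z1 + A4 • z2) := ⟨_, _, rfl⟩
  have mB : Lin Z z1 z2 (B3 • z1 + B4 • z2) := ⟨_, _, rfl⟩
  have mM : Lin Z z1 z2 (M3 • z1 + M4 • z2) := ⟨_, _, rfl⟩
  have mD : Lin Z z1 z2 (D3 • z1 + D4 • z2) := ⟨_, _, rfl⟩
  have mE : Lin Z z1 z2 (E3 • z1 + E4 • z2) := ⟨_, _, rfl⟩
  have mC : Lin Z z1 z2 (γ • z1 + δ • z2) := ⟨_, _, rfl⟩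
  generalize A1 • y1 + A2 • y2 = bA at *
  generalize B1 • y1 + B2 • y2 = bB at *
  generalize M1 • y1 + M2 • y2 = bM at *
  generalize D1 • y1 + D2 • y2 = bD at *
  generalize E1 • y1 + E2 • y2 = bE at *
  generalize α • y1 + β • y2 = b at *
  generalize A3 • z1 + A4 • z2 = cA at *
  generalize B3 • z1 + B4 • z2 = cB at *
  generalize M3 • z1 + M4 • z2 = cM at *
  generalize D3 • z1 + D4 • z2 = cD at *
  generalize E3 • z1 + E4 • z2 = cE at *
  generalize γ • z1 + δ • z2 = c at *
  obtain ⟨e, he, ey, ez, eX⟩ := comm_shape S aA dA aB dB bA cA bB cB lA lB mA mB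
  obtain ⟨f, hf, fy, fz, eY⟩ := comm_shape S aD dD aE dE bD cD bE cE lD lE mD mE
  rw [eX, eY]
  have lu := lB.comb lA (aA - dA) (aB - dB)
  have lw := lE.comb lD (aD - dD) (aE - dE)
  have mv := mA.comb mB (aB - dB) (aA - dA)
  have mz := mD.comb mE (aE - dE) (aD - dD)
  generalize hu : (aA - dA) • bB - (aB - dB) • bA = u at *
  generalize hw : (aD - dD) • bE - (aE - dE) • bD = w at *
  generalize hv : (aB - dB) • cA - (aA - dA) • cB = v at *
  generalize hz : (aE - dE) • cD - (aD - dD) • cE = z at *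
  have nyy : ∀ {n : Z} (_ : n • (y1 * y2) = 0) {x y : R} (_ : Lin Z y1 y2 x) (_ : Lin Z y1 y2 y),
      n • (x * y) = 0 := by
    intro n hn x y hx hy
    obtain ⟨k, hk⟩ := lin_mul S.y11 S.y22 S.y21 hx hy
    rw [hk, smul_comm, hn, smul_zero]
  have nzz : ∀ {n : Z} (_ : n • (z1 * z2) = 0) {x y : R} (_ : Lin Z z1 z2 x) (_ : Lin Z z1 z2 y),
      n • (x * y) = 0 := by
    intro n hn x y hx hy
    obtain ⟨k, hk⟩ := lin_mul S.z11 S.z22 S.z21 hx hy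
    rw [hk, smul_comm, hn, smul_zero]
  have efb : ∀ {x : R} (_ : Lin Z y1 y2 x), (e * f) • x = 0 := by
    intro x hx
    have h3 : (e * f) • x = e • ((f • (1 : R)) * x) := by simp [smul_smul]
    rw [h3, hf, sub_mul, mul_assoc, mul_assoc, S.cb hx mE, S.cb hx mD, mul_neg, mul_neg,
      ← mul_assoc, ← mul_assoc, smul_sub, smul_neg, smul_neg, ← smul_mul_assoc e (bD * x),
      ← smul_mul_assoc e (bE * x),
      nyy ey lD hx, nyy ey lE hx]
    simp
  have efc : ∀ {x : R} (_ : Lin Z z1 z2 x), (e * f) • x = 0 := by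
    intro x hx
    have h3 : (e * f) • x = e • ((f • (1 : R)) * x) := by simp [smul_smul]
    rw [h3, hf, sub_mul, mul_assoc, mul_assoc, smul_sub, ← mul_smul_comm e bD (cE * x),
      ← mul_smul_comm e bE (cD * x),
      nzz ez mE hx, nzz ez mD hx]
    simp
  have ay := fun {x y : R} (hx : Lin Z y1 y2 x) (hy : Lin Z y1 y2 y) =>
    lin_anti S.y11 S.y22 S.y21 hx hy
  have az := fun {x y : R} (hx : Lin Z z1 z2 x) (hy : Lin Z z1 z2 y) =>
    lin_anti S.z11 S.z22 S.z21 hx hy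
  simp only [sub_mul _ _ w, sub_mul _ _ u, sub_mul _ _ v, sub_mul _ _ z, smul_mul_assoc,
    sub_eq_zero] at uAw uBw uDu uEu vAz vBz vDv vEv
  have H1 := te_w (aA - dA) (aB - dB) (a - d) e bA bB cA cB b u v w he hv.symm uAw uBw
    (S.cb lw mA) (S.cb lw mB)
  have H2 := te_w (aD - dD) (aE - dE) (a - d) f bD bE cD cE b w z u hf hz.symm uDu uEu
    (S.cb lu mD) (S.cb lu mE)
  have H3 := te_z (aA - dA) (aB - dB) (a - d) e bA bB cA cB c u z he hu.symm vAz vBz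
  have H4 := te_z (aD - dD) (aE - dE) (a - d) f bD bE cD cE c w v hf hw.symm vDv vEv
  exact final_lemma a d p s e f (a - d) b bM u w c cM v z rfl hcan
    (ay lC lu) (ay lC lw) (S.cb lC mC) (S.cb lC mM) (S.cb lC mv) (S.cb lC mz)
    (S.cb lu mC) (S.cb lu mM) (S.cb lu mv) (S.cb lu mz)
    (S.cb lw mC) (S.cb lw mM) (S.cb lw mv) (S.cb lw mz)
    (S.cb lM mv) (S.cb lM mz) (S.cb lM mC)
    (az mC mM) (ay lC lM) (az mC mv) (az mC mz) uw vz
    (efb lC) (efc mC) (efb lM) (efc mM)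
    (nyy fy lC lu) (nyy ey lC lw) (nyy ey lC lM) (nyy fy lC lM)
    (nzz fz mC mM) (nzz ez mC mM) (nzz ez mC mz) (nzz fz mC mv) H1 H2 H3 H4

end Abs2

section Abs3
variable {Z R : Type*} [CommRing Z] [Ring R] [Algebra Z R]
variable {y1 y2 z1 z2 : R} {q11 q12 q21 q22 : Z}

def CD (y1 y2 z1 z2 : R) (t1 t2 : Z) (e : Z) (u v : R) : Prop :=
  ∃ tA A1 A2 A3 A4 tB B1 B2 B3 B4 : Z,
    tA • (y1 * y2) = (A1 * t1 + A2 * t2) • (y1 * y2) ∧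
    tA • (z1 * z2) = (A3 * t1 + A4 * t2) • (z1 * z2) ∧
    tB • (y1 * y2) = (B1 * t1 + B2 * t2) • (y1 * y2) ∧
    tB • (z1 * z2) = (B3 * t1 + B4 * t2) • (z1 * z2) ∧
    u = tA • (B1 • y1 + B2 • y2) - tB • (A1 • y1 + A2 • y2) ∧
    v = tB • (A3 • z1 + A4 • z2) - tA • (B3 • z1 + B4 • z2) ∧
    e • (1 : R) = (A1 • y1 + A2 • y2) * (B3 • z1 + B4 • z2)
      - (B1 • y1 + B2 • y2) * (A3 • z1 + A4 • z2) ∧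
    e • (y1 * y2) = 0 ∧ e • (z1 * z2) = 0

theorem CD.exists (S : SCS y1 y2 z1 z2 q11 q12 q21 q22) {t1 t2 : Z}
    {A B : Matrix (Fin 2) (Fin 2) R}
    (hA : Good Z y1 y2 z1 z2 t1 t2 A) (hB : Good Z y1 y2 z1 z2 t1 t2 B) :
    ∃ (e : Z) (u v : R), A * B - B * A = !![e • (1 : R), u; v, e • (1 : R)] ∧
      CD y1 y2 z1 z2 t1 t2 e u v := by
  obtain ⟨aA, dA, A1, A2, A3, A4, rfl, hA1, hA2⟩ := hA
  obtain ⟨aB, dB, B1, B2, B3, B4, rfl, hB1, hB2⟩ := hB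
  obtain ⟨e, he, ey, ez, eX⟩ := comm_shape S aA dA aB dB (A1 • y1 + A2 • y2) (A3 • z1 + A4 • z2)
    (B1 • y1 + B2 • y2) (B3 • z1 + B4 • z2) ⟨_, _, rfl⟩ ⟨_, _, rfl⟩ ⟨_, _, rfl⟩ ⟨_, _, rfl⟩
  exact ⟨e, _, _, eX, _, _, _, _, _, _, _, _, _, _, hA1, hA2, hB1, hB2, rfl, rfl, he, ey, ez⟩

theorem CD.lu {t1 t2 e : Z} {u v : R} (h : CD y1 y2 z1 z2 t1 t2 e u v) : Lin Z y1 y2 u := by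
  obtain ⟨tA, A1, A2, A3, A4, tB, B1, B2, B3, B4, hA1, hA2, hB1, hB2, rfl, rfl, he, ey, ez⟩ := h
  exact Lin.comb ⟨_, _, rfl⟩ ⟨_, _, rfl⟩ _ _

theorem CD.lv {t1 t2 e : Z} {u v : R} (h : CD y1 y2 z1 z2 t1 t2 e u v) : Lin Z z1 z2 v := by
  obtain ⟨tA, A1, A2, A3, A4, tB, B1, B2, B3, B4, hA1, hA2, hB1, hB2, rfl, rfl, he, ey, ez⟩ := h
  exact Lin.comb ⟨_, _, rfl⟩ ⟨_, _, rfl⟩ _ _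

theorem CD.uw (S : SCS y1 y2 z1 z2 q11 q12 q21 q22) {t1 t2 e f : Z} {u v w z : R}
    (h : CD y1 y2 z1 z2 t1 t2 e u v) (h' : CD y1 y2 z1 z2 t1 t2 f w z) :
    u * w = 0 ∧ v * z = 0 := by
  obtain ⟨tA, A1, A2, A3, A4, tB, B1, B2, B3, B4, hA1, hA2, hB1, hB2, rfl, rfl, he, ey, ez⟩ := h
  obtain ⟨tD, D1, D2, D3, D4, tE, E1, E2, E3, E4, hD1, hD2, hE1, hE2, rfl, rfl, hf, fy, fz⟩ := h'
  exact ⟨uw_zero S.y11 S.y22 S.y21 t1 t2 _ _ _ _ _ _ _ _ _ _ _ _ hA1 hB1 hD1 hE1,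
    uw_zero S.z11 S.z22 S.z21 t1 t2 _ _ _ _ _ _ _ _ _ _ _ _ hB2 hA2 hE2 hD2⟩

theorem CD.tez (S : SCS y1 y2 z1 z2 q11 q12 q21 q22) {t1 t2 e f : Z} {u v w z : R}
    (h : CD y1 y2 z1 z2 t1 t2 e u v) (h' : CD y1 y2 z1 z2 t1 t2 f w z) (t γ δ : Z)
    (ht : t • (z1 * z2) = (γ * t1 + δ * t2) • (z1 * z2)) :
    (t * e) • z = -(u * ((γ • z1 + δ • z2) * z)) := by
  obtain ⟨tA, A1, A2, A3, A4, tB, B1, B2, B3, B4, hA1, hA2, hB1, hB2, hu, hv, he, ey, ez⟩ := h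
  obtain ⟨tD, D1, D2, D3, D4, tE, E1, E2, E3, E4, hD1, hD2, hE1, hE2, hw, hz, hf, fy, fz⟩ := h'
  have vA := uw_zero S.z11 S.z22 S.z21 t1 t2 _ _ _ _ _ _ _ _ _ _ _ _ ht hA2 hE2 hD2
  have vB := uw_zero S.z11 S.z22 S.z21 t1 t2 _ _ _ _ _ _ _ _ _ _ _ _ ht hB2 hE2 hD2
  rw [← hz, sub_mul, smul_mul_assoc, smul_mul_assoc, sub_eq_zero] at vA vB
  exact te_z tA tB t e _ _ _ _ _ u z he hu vA vB

theorem CD.eqz (S : SCS y1 y2 z1 z2 q11 q12 q21 q22) {t1 t2 e f g : Z} {u v w z q r : R}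
    (h : CD y1 y2 z1 z2 t1 t2 e u v) (h' : CD y1 y2 z1 z2 t1 t2 f w z)
    (h'' : CD y1 y2 z1 z2 t1 t2 g q r) (t γ δ : Z)
    (ht : t • (z1 * z2) = (γ * t1 + δ * t2) • (z1 * z2))
    (hcan : ∀ x : R, t • x = 0 → x = 0) : e • (q * z) = 0 := by
  apply hcan
  rw [smul_smul, ← mul_smul_comm, CD.tez S h h' t γ δ ht, mul_neg, ← mul_assoc,
    (CD.uw S h'' h).1, zero_mul, neg_zero]

theorem CD.efb (S : SCS y1 y2 z1 z2 q11 q12 q21 q22) {t1 t2 e f : Z} {u v w z : R}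
    (h : CD y1 y2 z1 z2 t1 t2 e u v) (h' : CD y1 y2 z1 z2 t1 t2 f w z) {x : R}
    (hx : Lin Z y1 y2 x) : (e * f) • x = 0 := by
  obtain ⟨tA, A1, A2, A3, A4, tB, B1, B2, B3, B4, hA1, hA2, hB1, hB2, hu, hv, he, ey, ez⟩ := h
  obtain ⟨tD, D1, D2, D3, D4, tE, E1, E2, E3, E4, hD1, hD2, hE1, hE2, hw, hz, hf, fy, fz⟩ := h'
  have nyy : ∀ {x y : R} (_ : Lin Z y1 y2 x) (_ : Lin Z y1 y2 y), e • (x * y) = 0 := by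
    intro x y hx hy
    obtain ⟨k, hk⟩ := lin_mul S.y11 S.y22 S.y21 hx hy
    rw [hk, smul_comm, ey, smul_zero]
  have mE : Lin Z z1 z2 (E3 • z1 + E4 • z2) := ⟨_, _, rfl⟩
  have mD : Lin Z z1 z2 (D3 • z1 + D4 • z2) := ⟨_, _, rfl⟩
  have lE : Lin Z y1 y2 (E1 • y1 + E2 • y2) := ⟨_, _, rfl⟩
  have lD : Lin Z y1 y2 (D1 • y1 + D2 • y2) := ⟨_, _, rfl⟩
  have h3 : (e * f) • x = e • ((f • (1 : R)) * x) := by simp [smul_smul]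
  generalize E3 • z1 + E4 • z2 = cE at *
  generalize D3 • z1 + D4 • z2 = cD at *
  generalize E1 • y1 + E2 • y2 = bE at *
  generalize D1 • y1 + D2 • y2 = bD at *
  rw [h3, hf, sub_mul, mul_assoc, mul_assoc, S.cb hx mE, S.cb hx mD, mul_neg, mul_neg,
      ← mul_assoc, ← mul_assoc, smul_sub, smul_neg, smul_neg, ← smul_mul_assoc e (bD * x),
      ← smul_mul_assoc e (bE * x), nyy lD hx, nyy lE hx]
  simp

theorem CD.efc (S : SCS y1 y2 z1 z2 q11 q12 q21 q22) {t1 t2 e f : Z} {u v w z : R}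
    (h : CD y1 y2 z1 z2 t1 t2 e u v) (h' : CD y1 y2 z1 z2 t1 t2 f w z) {x : R}
    (hx : Lin Z z1 z2 x) : (e * f) • x = 0 := by
  obtain ⟨tA, A1, A2, A3, A4, tB, B1, B2, B3, B4, hA1, hA2, hB1, hB2, hu, hv, he, ey, ez⟩ := h
  obtain ⟨tD, D1, D2, D3, D4, tE, E1, E2, E3, E4, hD1, hD2, hE1, hE2, hw, hz, hf, fy, fz⟩ := h'
  have nzz : ∀ {x y : R} (_ : Lin Z z1 z2 x) (_ : Lin Z z1 z2 y), e • (x * y) = 0 := by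
    intro x y hx hy
    obtain ⟨k, hk⟩ := lin_mul S.z11 S.z22 S.z21 hx hy
    rw [hk, smul_comm, ez, smul_zero]
  have mE : Lin Z z1 z2 (E3 • z1 + E4 • z2) := ⟨_, _, rfl⟩
  have mD : Lin Z z1 z2 (D3 • z1 + D4 • z2) := ⟨_, _, rfl⟩
  have h3 : (e * f) • x = e • ((f • (1 : R)) * x) := by simp [smul_smul]
  rw [h3, hf, sub_mul, mul_assoc, mul_assoc, smul_sub, ← mul_smul_comm e _ (_ * x),
      ← mul_smul_comm e _ (_ * x), nzz mE hx, nzz mD hx]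
  simp

theorem CD.efg (S : SCS y1 y2 z1 z2 q11 q12 q21 q22) {t1 t2 e f g : Z} {u v w z q r : R}
    (h : CD y1 y2 z1 z2 t1 t2 e u v) (h' : CD y1 y2 z1 z2 t1 t2 f w z)
    (h'' : CD y1 y2 z1 z2 t1 t2 g q r) : (e * f * g) • (1 : R) = 0 := by
  obtain ⟨tA, A1, A2, A3, A4, tB, B1, B2, B3, B4, hA1, hA2, hB1, hB2, hu, hv, he, ey, ez⟩ := h''
  rw [mul_smul, he, smul_sub, ← smul_mul_assoc, ← smul_mul_assoc,
    CD.efb S h h' ⟨_, _, rfl⟩, CD.efb S h h' ⟨_, _, rfl⟩]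
  simp

theorem triple_abs (S : SCS y1 y2 z1 z2 q11 q12 q21 q22) {t1 t2 e f g : Z} {u v w z q r : R}
    (h : CD y1 y2 z1 z2 t1 t2 e u v) (h' : CD y1 y2 z1 z2 t1 t2 f w z)
    (h'' : CD y1 y2 z1 z2 t1 t2 g q r) (t γ δ : Z)
    (ht : t • (z1 * z2) = (γ * t1 + δ * t2) • (z1 * z2))
    (hcan : ∀ x : R, t • x = 0 → x = 0) :
    !![e • (1 : R), u; v, e • (1 : R)] * !![g • (1 : R), q; r, g • (1 : R)]
      * !![f • (1 : R), w; z, f • (1 : R)] = 0 := by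
  have k1 := CD.efg S h h'' h'
  have k2 : f • (u * r) = 0 := CD.eqz S h' h'' h t γ δ ht hcan
  have k3 : e • (q * z) = 0 := CD.eqz S h h' h'' t γ δ ht hcan
  have k4 : g • (u * z) = 0 := CD.eqz S h'' h' h t γ δ ht hcan
  have k5 : f • (q * v) = 0 := CD.eqz S h' h h'' t γ δ ht hcan
  have k6 : e • (w * r) = 0 := CD.eqz S h h'' h' t γ δ ht hcan
  have k7 : g • (w * v) = 0 := CD.eqz S h'' h h' t γ δ ht hcan
  have rw' := S.cb h'.lu h''.lv
  have vq := S.cb h''.lu h.lv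
  have vw := S.cb h'.lu h.lv
  have h3 : u * (r * w) = 0 := by rw [rw', mul_neg, ← mul_assoc, (CD.uw S h h').1]; simp
  have h4 : v * (q * z) = 0 := by
    rw [← mul_assoc, vq, neg_mul, mul_assoc, (CD.uw S h h').2]; simp
  have l1 := CD.efb S h h'' h'.lu
  have l2 := CD.efb S h h' h''.lu
  have l3 := CD.efb S h'' h' h.lu
  have l4 := CD.efc S h'' h' h.lv
  have l5 := CD.efc S h h' h''.lv
  have l6 := CD.efc S h h'' h'.lv
  ext i j
  fin_cases i <;> fin_cases j <;>
      simp only [Matrix.mul_apply, Fin.sum_univ_two, Matrix.of_apply, Matrix.cons_val_zero,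
        Matrix.cons_val_one, Matrix.cons_val', Matrix.cons_val_fin_one, Fin.zero_eta, Fin.mk_one,
        Fin.isValue, add_mul, mul_assoc, smul_mul_assoc, mul_smul_comm, one_mul, mul_one,
        Matrix.zero_apply, h3, h4, rw', vq, vw, neg_mul, mul_neg, (CD.uw S h h').2,
        zero_assoc (CD.uw S h h').1, mul_zero]
  · linear_combination (norm := module) (1 : Z) • (k1 + k2 + k3 + k4)
  · linear_combination (norm := module) (1 : Z) • (l1 + l2 + l3)
  · linear_combination (norm := module) (1 : Z) • (l4 + l5 + l6)
  · linear_combination (norm := module) (1 : Z) • (k1 - k5 - k6 - k7)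

end Abs3

section Conc
variable (K : Type*) [Field K]

theorem yg_mul (i j : Fin 4) : yg K i * yg K j =
    1 ⊗ₜ[K] (ExteriorAlgebra.ι K (Pi.single i 1) * ExteriorAlgebra.ι K (Pi.single j 1)) := by
  simp [yg]

theorem yg_sq (i : Fin 4) : yg K i * yg K i = 0 := by
  rw [yg_mul, ExteriorAlgebra.ι_sq_zero, TensorProduct.tmul_zero]

theorem yg_anti (i j : Fin 4) : yg K i * yg K j = -(yg K j * yg K i) := by
  rw [yg_mul, yg_mul, ← TensorProduct.tmul_neg,
    eq_neg_of_add_eq_zero_left (ExteriorAlgebra.ι_add_mul_swap (R := K) _ _)]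

theorem ext_comm (a b : Fin 4 → K) (m : ExteriorAlgebra K (Fin 4 → K)) :
    Commute m (ExteriorAlgebra.ι K a * ExteriorAlgebra.ι K b) := by
  induction m using ExteriorAlgebra.induction with
  | algebraMap r => exact Algebra.commutes r _
  | ι x =>
    have h1 := eq_neg_of_add_eq_zero_left (ExteriorAlgebra.ι_add_mul_swap (R := K) x a)
    have h2 := eq_neg_of_add_eq_zero_left (ExteriorAlgebra.ι_add_mul_swap (R := K) x b)
    change _ * _ = _ * _
    rw [← mul_assoc, h1, neg_mul, mul_assoc, h2, mul_neg, neg_neg, mul_assoc]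
  | mul a b ha hb => exact ha.mul_left hb
  | add a b ha hb => exact ha.add_left hb

theorem tens_central (p : MvPolynomial (Fin 4) K) (n : ExteriorAlgebra K (Fin 4 → K))
    (hn : ∀ m, Commute m n) : (p ⊗ₜ[K] n : FreeSuperComm K) ∈ Subring.center (FreeSuperComm K) := by
  rw [Subring.mem_center_iff]
  intro g
  induction g using TensorProduct.induction_on with
  | zero => simp
  | tmul q m => rw [Algebra.TensorProduct.tmul_mul_tmul, Algebra.TensorProduct.tmul_mul_tmul,
      mul_comm, (hn m).eq]
  | add a b ha hb => rw [add_mul, mul_add, ha, hb]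

def xc (i : Fin 4) : Subring.center (FreeSuperComm K) :=
  ⟨xg K i, tens_central K _ _ fun m => Commute.one_right m⟩

def qc (i j : Fin 4) : Subring.center (FreeSuperComm K) :=
  ⟨yg K i * yg K j, by rw [yg_mul]; exact tens_central K _ _ (ext_comm K _ _)⟩

theorem scs : SCS (yg K 0) (yg K 2) (yg K 1) (yg K 3) (qc K 0 1) (qc K 0 3) (qc K 2 1) (qc K 2 3) := by
  constructor <;> first
    | exact yg_sq K _
    | exact yg_anti K _ _
    | simp [Subring.smul_def, qc]

theorem can (i j : Fin 4) (hij : i ≠ j) (x : FreeSuperComm K) (h : (xc K i - xc K j) • x = 0) :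
    x = 0 := by
  have hne : (MvPolynomial.X i - MvPolynomial.X j : MvPolynomial (Fin 4) K) ≠ 0 := by
    rw [sub_ne_zero]
    exact fun h => hij (MvPolynomial.X_injective h)
  have hinj : Function.Injective
      (LinearMap.mulLeft K (MvPolynomial.X i - MvPolynomial.X j : MvPolynomial (Fin 4) K)) :=
    fun a b hab => mul_left_cancel₀ hne hab
  have hinj2 := Module.Flat.rTensor_preserves_injective_linearMap
    (M := ExteriorAlgebra K (Fin 4 → K)) _ hinj
  have key : ∀ y : FreeSuperComm K, LinearMap.rTensor (ExteriorAlgebra K (Fin 4 → K))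
      (LinearMap.mulLeft K (MvPolynomial.X i - MvPolynomial.X j : MvPolynomial (Fin 4) K)) y
      = (xc K i - xc K j) • y := by
    intro y
    induction y using TensorProduct.induction_on with
    | zero => simp
    | tmul q m =>
      simp [Subring.smul_def, xc, xg, sub_mul, TensorProduct.sub_tmul]
    | add a b ha hb => rw [map_add, ha, hb, smul_add]
  apply hinj2
  rw [key, h, map_zero]

theorem genC1_eq : genC₁ K = !![xc K 0 • (1 : FreeSuperComm K),
    (1 : Subring.center (FreeSuperComm K)) • yg K 0 + (0 : Subring.center (FreeSuperComm K)) • yg K 2;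
    (1 : Subring.center (FreeSuperComm K)) • yg K 1 + (0 : Subring.center (FreeSuperComm K)) • yg K 3,
    xc K 1 • (1 : FreeSuperComm K)] := by
  simp [genC₁, Subring.smul_def, xc]

theorem genC2_eq : genC₂ K = !![xc K 2 • (1 : FreeSuperComm K),
    (0 : Subring.center (FreeSuperComm K)) • yg K 0 + (1 : Subring.center (FreeSuperComm K)) • yg K 2;
    (0 : Subring.center (FreeSuperComm K)) • yg K 1 + (1 : Subring.center (FreeSuperComm K)) • yg K 3,
    xc K 3 • (1 : FreeSuperComm K)] := by
  simp [genC₂, Subring.smul_def, xc]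

theorem good_of_mem (M : Matrix (Fin 2) (Fin 2) (FreeSuperComm K)) (hM : M ∈ Falg K) :
    Good (Subring.center (FreeSuperComm K)) (yg K 0) (yg K 2) (yg K 1) (yg K 3)
      (xc K 0 - xc K 1) (xc K 2 - xc K 3) M := by
  refine Algebra.adjoin_induction (p := fun M _ => Good (Subring.center (FreeSuperComm K))
    (yg K 0) (yg K 2) (yg K 1) (yg K 3) (xc K 0 - xc K 1) (xc K 2 - xc K 3) M) ?_ ?_ ?_ ?_ hM
  · rintro x (rfl | rfl)
    · exact ⟨_, _, _, _, _, _, genC1_eq K, by simp, by simp⟩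
    · exact ⟨_, _, _, _, _, _, genC2_eq K, by simp, by simp⟩
  · intro k
    have hk : algebraMap K (FreeSuperComm K) k ∈ Subring.center (FreeSuperComm K) :=
      Subring.mem_center_iff.2 fun g => (Algebra.commutes k g).symm
    have : algebraMap K (Matrix (Fin 2) (Fin 2) (FreeSuperComm K)) k =
        !![(⟨_, hk⟩ : Subring.center (FreeSuperComm K)) • (1 : FreeSuperComm K), 0; 0,
          (⟨_, hk⟩ : Subring.center (FreeSuperComm K)) • (1 : FreeSuperComm K)] := by
      ext i j
      fin_cases i <;> fin_cases j <;> simp [Matrix.algebraMap_matrix_apply, Subring.smul_def]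
    rw [this]
    exact Good.scal _
  · intro x y _ _ hx hy
    exact hx.add hy
  · intro x y _ _ hx hy
    exact Good.mul (scs K) hx hy

end Conc

theorem second_part {A : Type*} [Ring A] (X Y a b : A) (h : X * a * Y * b - b * (X * a * Y) = 0)
    (h' : X * (b * a - a * b) * Y = 0) :
    X * a * (Y * b - b * Y) + (X * b - b * X) * a * Y = 0 := by
  have hs := congrArg₂ (· + ·) h h'
  simp only [add_zero] at hs
  rw [← hs]
  noncomm_ring

/- STATEMENT 19: [[t1,t2] t3 [t4,t5], t6] is a polynomial identity of F, and consequently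
[t1,t2] t3 [t4,t5,t6] + [t1,t2,t6] t3 [t4,t5] = 0 holds identically on F. -/
theorem stmt19 (K : Type*) [Field K] [CharZero K]
    (a₁ a₂ a₃ a₄ a₅ a₆ : Matrix (Fin 2) (Fin 2) (FreeSuperComm K))
    (h₁ : a₁ ∈ Falg K) (h₂ : a₂ ∈ Falg K) (h₃ : a₃ ∈ Falg K)
    (h₄ : a₄ ∈ Falg K) (h₅ : a₅ ∈ Falg K) (h₆ : a₆ ∈ Falg K) :
    ((a₁ * a₂ - a₂ * a₁) * a₃ * (a₄ * a₅ - a₅ * a₄)) * a₆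
        - a₆ * ((a₁ * a₂ - a₂ * a₁) * a₃ * (a₄ * a₅ - a₅ * a₄)) = 0
    ∧ (a₁ * a₂ - a₂ * a₁) * a₃ * ((a₄ * a₅ - a₅ * a₄) * a₆ - a₆ * (a₄ * a₅ - a₅ * a₄))
        + ((a₁ * a₂ - a₂ * a₁) * a₆ - a₆ * (a₁ * a₂ - a₂ * a₁)) * a₃ * (a₄ * a₅ - a₅ * a₄)
        = 0 := by
  have g₁ := good_of_mem K a₁ h₁
  have g₂ := good_of_mem K a₂ h₂
  have g₃ := good_of_mem K a₃ h₃
  have g₄ := good_of_mem K a₄ h₄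
  have g₅ := good_of_mem K a₅ h₅
  have gen : ∀ x ∈ ({genC₁ K, genC₂ K} : Set (Matrix (Fin 2) (Fin 2) (FreeSuperComm K))),
      (a₁ * a₂ - a₂ * a₁) * a₃ * (a₄ * a₅ - a₅ * a₄) * x
        = x * ((a₁ * a₂ - a₂ * a₁) * a₃ * (a₄ * a₅ - a₅ * a₄)) := by
    rintro x (rfl | rfl)
    · rw [genC1_eq]
      exact main_abs (scs K) g₁ g₂ g₃ g₄ g₅ _ _ _ _ _ _ (by simp) (by simp)
        (can K 0 1 (by decide))
    · rw [genC2_eq]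
      exact main_abs (scs K) g₁ g₂ g₃ g₄ g₅ _ _ _ _ _ _ (by simp) (by simp)
        (can K 2 3 (by decide))
  have h : ∀ x ∈ Falg K, (a₁ * a₂ - a₂ * a₁) * a₃ * (a₄ * a₅ - a₅ * a₄) * x
        = x * ((a₁ * a₂ - a₂ * a₁) * a₃ * (a₄ * a₅ - a₅ * a₄)) := by
    have hle : Falg K ≤ Subalgebra.centralizer K
        {(a₁ * a₂ - a₂ * a₁) * a₃ * (a₄ * a₅ - a₅ * a₄)} := by
      refine Algebra.adjoin_le fun x hx => ?_
      rw [SetLike.mem_coe, Subalgebra.mem_centralizer_iff]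
      rintro _ rfl
      exact gen x hx
    intro x hx
    exact Subalgebra.mem_centralizer_iff K |>.1 (hle hx) _ rfl
  have h6 := sub_eq_zero.2 (h a₆ h₆)
  have trip : (a₁ * a₂ - a₂ * a₁) * (a₆ * a₃ - a₃ * a₆) * (a₄ * a₅ - a₅ * a₄) = 0 := by
    obtain ⟨e, u, v, hX, cX⟩ := CD.exists (scs K) g₁ g₂
    obtain ⟨f, w, z, hY, cY⟩ := CD.exists (scs K) g₄ g₅
    obtain ⟨g, q, r, hM, cM⟩ := CD.exists (scs K) (good_of_mem K a₆ h₆) g₃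
    rw [hX, hY, hM]
    exact triple_abs (scs K) cX cY cM (xc K 0 - xc K 1) 1 0 (by simp) (can K 0 1 (by decide))
  refine ⟨h6, ?_⟩
  exact second_part _ _ _ _ h6 trip
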